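/- (Theorem 3.5, discrete form.) Let m ≥ 1, let (S_n)_{n≥1} be service durations with S_n > 0 and (τ_n)_{n≥0} inter-arrival times with τ_n ≥ 0, and let U_0 ∈ ℝ^c be a workload vector. Define four processes as follows: U^c in ℝ^c starts at U_0; L^c in ℝ^c starts at the zero vector; U^{c+m} in ℝ^{c+m} starts at the zero-padding of U_0 (m zero coordinates followed by the coordinates of U_0); L^{c+m} in ℝ^{c+m} starts at the zero vector; and each process X evolves by the pre-arrival/post-arrival recursion X̃_n = dec_{τ_n}(X_n), X_{n+1} = arr_{S_{n+1}}(X̃_n). Suppose that for every n such that L̃^c_n ≠ Ũ^c_n, the implication holds: if L̃^c_n(1) = Ũ^c_n(1) then Ũ^c_n(1) = 0. Then for every n ≥ 0, C(L^{c+m}_n, U^{c+m}_n) ≤ C(L^c_n, U^c_n) and C(L̃^{c+m}_n, Ũ^{c+m}_n) ≤ C(L̃^c_n, Ũ^c_n); in particular, whenever the c-server sandwiching processes have coalesced, so have the (c+m)-server sandwiching processes. -/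

import Mathlib

open scoped Classical

noncomputable section

/-- The `k`-th coordinate (0-based) of a vector in `ℝ^n`, defaulting to 0 out of range. -/
def coord {n : ℕ} (V : Fin n → ℝ) (k : ℕ) : ℝ :=
  if h : k < n then V ⟨k, h⟩ else 0

/-- A workload vector: coordinates nonnegative and in increasing order. -/
def IsWorkload {n : ℕ} (V : Fin n → ℝ) : Prop :=
  Monotone V ∧ ∀ i, 0 ≤ V i

/-- Add the service duration `S` to the minimal (first) coordinate. -/
def bump {n : ℕ} (S : ℝ) (V : Fin n → ℝ) : Fin n → ℝ :=
  fun i => if (i : ℕ) = 0 then V i + S else V i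

/-- The arrival step: increasing rearrangement of the vector obtained from `V`
by replacing its minimal coordinate `V(1)` by `V(1) + S`. -/
def arr {n : ℕ} (S : ℝ) (V : Fin n → ℝ) : Fin n → ℝ :=
  bump S V ∘ Tuple.sort (bump S V)

/-- The decay step: each coordinate decreases by `t`, truncated at 0. -/
def dec {n : ℕ} (t : ℝ) (V : Fin n → ℝ) : Fin n → ℝ :=
  fun i => max (V i - t) 0

/-- The Kiefer-Wolfowitz one-step update with service `S` and elapsed time `t`. -/
def step {n : ℕ} (S t : ℝ) (V : Fin n → ℝ) : Fin n → ℝ :=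
  dec t (arr S V)

/-- `kU S V` (1-based): the least `k ∈ {1,…,n−1}` with `V(1)+S ≤ V(k+1)`
(0-based: `coord V 0 + S ≤ coord V k`), and `n` if there is no such `k`. -/
def kU {n : ℕ} (S : ℝ) (V : Fin n → ℝ) : ℕ :=
  sInf ({k : ℕ | 1 ≤ k ∧ k < n ∧ coord V 0 + S ≤ coord V k} ∪ {n})

/-- `OrdDom V W` (i.e. `V ⊴ W`): each of the `c` busiest servers of `V ∈ ℝ^{c+m}`
has no more work than the corresponding server of `W ∈ ℝ^c`. -/
def OrdDom {c m : ℕ} (V : Fin (c + m) → ℝ) (W : Fin c → ℝ) : Prop :=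
  ∀ k : ℕ, k < c → coord V (k + m) ≤ coord W k

/-- The time-to-coalescence `C(L,U)`: equal to `U(n)` for
`n = max{k : L(k) ≠ U(k)}` when `L ≠ U`, and `0` when `L = U`. -/
def coalTime {n : ℕ} (L U : Fin n → ℝ) : ℝ :=
  if L = U then 0 else coord U (sSup {k : ℕ | k < n ∧ coord L k ≠ coord U k})

end

/-- The number of servers whose workload exceeds `x`. -/
noncomputable def countAbove {n : ℕ} (V : Fin n → ℝ) (x : ℝ) : ℕ :=
  (Finset.univ.filter fun i => x < V i).card

/-- Domination of the busiest servers, in terms of counts: for every level `x`, either all servers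
of `U` are above `x`, or `V` has no more servers above `x` than `U`. -/
def CountDom {a b : ℕ} (V : Fin a → ℝ) (U : Fin b → ℝ) : Prop :=
  ∀ x, b ≤ countAbove U x ∨ countAbove V x ≤ countAbove U x

lemma coord_eq {n : ℕ} (V : Fin n → ℝ) (i : Fin n) : coord V i = V i := by
  simp [coord]

lemma countAbove_le {n : ℕ} (V : Fin n → ℝ) (x : ℝ) : countAbove V x ≤ n :=
  (Finset.card_filter_le _ _).trans_eq (Finset.card_fin n)

lemma countAbove_eq_sum {n : ℕ} (V : Fin n → ℝ) (x : ℝ) :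
    countAbove V x = ∑ i, if x < V i then 1 else 0 :=
  Finset.card_filter _ _

lemma lt_iff_le_countAbove {n : ℕ} {V : Fin n → ℝ} (hV : Monotone V) (i : Fin n) (x : ℝ) :
    x < V i ↔ n - i ≤ countAbove V x := by
  constructor
  · intro h
    rw [← Fin.card_Ici]
    refine Finset.card_le_card fun j hj => ?_
    simpa using h.trans_le (hV (Finset.mem_Ici.1 hj))
  · intro h
    by_contra hx
    have hsub : countAbove V x ≤ (Finset.Ioi i).card := by
      refine Finset.card_le_card fun j hj => ?_
      rw [Finset.mem_Ioi]
      by_contra hji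
      exact hx ((Finset.mem_filter.1 hj).2.trans_le (hV (not_lt.1 hji)))
    rw [Fin.card_Ioi] at hsub
    have := i.2
    omega

lemma lt_coord_zero_iff {n : ℕ} (hn : 0 < n) {V : Fin n → ℝ} (hV : Monotone V) (x : ℝ) :
    x < coord V 0 ↔ countAbove V x = n := by
  have h := lt_iff_le_countAbove hV ⟨0, hn⟩ x
  have := countAbove_le V x
  rw [← coord_eq V] at h
  simp only [h]
  omega

lemma coord_zero_nonneg {n : ℕ} {V : Fin n → ℝ} (hV : IsWorkload V) : 0 ≤ coord V 0 := by
  unfold coord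
  split_ifs
  · exact hV.2 _
  · exact le_rfl

lemma CountDom.countAbove_le_countAbove {n : ℕ} {L U : Fin n → ℝ} (h : CountDom L U) (x : ℝ) :
    countAbove L x ≤ countAbove U x :=
  (h x).elim (fun hx => (countAbove_le L x).trans hx) id

lemma CountDom.le {n : ℕ} {L U : Fin n → ℝ} (h : CountDom L U) (hL : Monotone L)
    (hU : Monotone U) : L ≤ U := by
  intro i
  by_contra hi
  have h1 := (lt_iff_le_countAbove hL i (U i)).1 (not_le.1 hi)
  exact lt_irrefl _ ((lt_iff_le_countAbove hU i (U i)).2 (h1.trans (h.countAbove_le_countAbove _)))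

lemma CountDom.coord_zero_le {a b : ℕ} (hb : 0 < b) (hab : b ≤ a) {V : Fin a → ℝ} {U : Fin b → ℝ}
    (h : CountDom V U) (hV : Monotone V) (hU : Monotone U) : coord V 0 ≤ coord U 0 := by
  by_contra hlt
  have h1 := (lt_coord_zero_iff (hb.trans_le hab) hV _).1 (not_le.1 hlt)
  have h2 := mt (lt_coord_zero_iff hb hU (coord U 0)).2 (lt_irrefl _)
  have h3 := countAbove_le U (coord U 0)
  rcases h (coord U 0) with h | h <;> omega

lemma CountDom.of_le {n : ℕ} {L U : Fin n → ℝ} (h : L ≤ U) : CountDom L U := fun x =>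
  Or.inr <| Finset.card_le_card <|
    Finset.monotone_filter_right _ fun i _ (hi : x < L i) => hi.trans_le (h i)

lemma OrdDom.countDom {c m : ℕ} {V : Fin (c + m) → ℝ} {U : Fin c → ℝ} (h : OrdDom V U)
    (hV : Monotone V) (hU : Monotone U) : CountDom V U := by
  intro x
  by_contra! hx
  obtain ⟨h1, h2⟩ := hx
  let j : Fin c := ⟨c - countAbove U x - 1, by omega⟩
  let j' : Fin (c + m) := ⟨c - countAbove U x - 1 + m, by omega⟩
  have hU' := mt (lt_iff_le_countAbove hU j x).1 (by simp only [j]; omega)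
  have hV' := (lt_iff_le_countAbove hV j' x).2 (by simp only [j']; omega)
  have hj := h j j.2
  rw [coord_eq] at hj
  have hj' : coord V (j + m) = V j' := coord_eq V j'
  linarith

lemma countAbove_dec {n : ℕ} (V : Fin n → ℝ) {t x : ℝ} (hx : 0 ≤ x) :
    countAbove (dec t V) x = countAbove V (x + t) := by
  unfold countAbove dec
  congr 1
  ext i
  simp only [Finset.mem_filter, lt_max_iff, hx.not_gt, or_false, lt_sub_iff_add_lt]

lemma countAbove_of_neg {n : ℕ} {V : Fin n → ℝ} (hV : IsWorkload V) {x : ℝ} (hx : x < 0) :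
    countAbove V x = n := by
  unfold countAbove
  rw [Finset.filter_true_of_mem fun i _ => hx.trans_le (hV.2 i)]
  simp

lemma countAbove_arr {n : ℕ} (hn : 0 < n) (S : ℝ) (V : Fin n → ℝ) (x : ℝ) :
    countAbove (arr S V) x + (if x < coord V 0 then 1 else 0) =
      countAbove V x + (if x < coord V 0 + S then 1 else 0) := by
  have hperm : countAbove (arr S V) x = countAbove (bump S V) x := by
    simp only [countAbove_eq_sum]
    exact Equiv.sum_comp (Tuple.sort (bump S V)) fun i => if x < bump S V i then 1 else 0
  rw [hperm]
  obtain ⟨k, rfl⟩ : ∃ k, n = k + 1 := ⟨n - 1, by omega⟩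
  have h0 : coord V 0 = V 0 := coord_eq V 0
  simp only [countAbove_eq_sum, Fin.sum_univ_succ, bump, h0, Fin.val_zero, Fin.val_succ, if_true,
    Nat.add_eq_zero_iff, one_ne_zero, and_false, if_false]
  ring

lemma IsWorkload.dec {n : ℕ} {V : Fin n → ℝ} (hV : IsWorkload V) (t : ℝ) :
    IsWorkload (dec t V) :=
  ⟨fun _ _ hij => max_le_max (sub_le_sub_right (hV.1 hij) t) le_rfl, fun _ => le_max_right _ _⟩

lemma IsWorkload.arr {n : ℕ} {V : Fin n → ℝ} (hV : IsWorkload V) {S : ℝ} (hS : 0 ≤ S) :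
    IsWorkload (arr S V) := by
  refine ⟨Tuple.monotone_sort _, fun i => ?_⟩
  simp only [_root_.arr, Function.comp, bump]
  split_ifs
  · exact add_nonneg (hV.2 _) hS
  · exact hV.2 _

lemma CountDom.dec {a b : ℕ} {V : Fin a → ℝ} {U : Fin b → ℝ} (h : CountDom V U)
    (hU : IsWorkload U) (t : ℝ) : CountDom (dec t V) (dec t U) := by
  intro x
  rcases lt_or_ge x 0 with hx | hx
  · exact Or.inl (countAbove_of_neg (hU.dec t) hx).ge
  · rw [countAbove_dec _ hx, countAbove_dec _ hx]
    exact h _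

lemma CountDom.arr {a b : ℕ} (hb : 0 < b) (hab : b ≤ a) {V : Fin a → ℝ} {U : Fin b → ℝ}
    (h : CountDom V U) (hV : Monotone V) (hU : Monotone U) {S : ℝ} (hS : 0 ≤ S) :
    CountDom (arr S V) (arr S U) := by
  intro x
  have h0 := h.coord_zero_le hb hab hV hU
  have hVx := countAbove_arr (hb.trans_le hab) S V x
  have hUx := countAbove_arr hb S U x
  have hfull := lt_coord_zero_iff hb hU x
  have := countAbove_le U x
  have := h x
  by_cases hx : x < coord U 0
  · left
    rw [if_pos hx, if_pos (by linarith), hfull.1 hx] at hUx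
    omega
  · rw [if_neg hx] at hUx
    rw [if_neg (by linarith)] at hVx
    have := mt hfull.2 hx
    right
    by_cases hxV : x < coord V 0 + S
    · rw [if_pos hxV] at hVx
      rw [if_pos (by linarith)] at hUx
      omega
    · rw [if_neg hxV] at hVx
      omega

lemma coalTime_nonneg {n : ℕ} (L : Fin n → ℝ) {U : Fin n → ℝ} (hU : IsWorkload U) :
    0 ≤ coalTime L U := by
  unfold coalTime coord
  split_ifs
  · exact le_rfl
  · exact hU.2 _
  · exact le_rfl

lemma coalTime_le_iff {n : ℕ} {L U : Fin n → ℝ} (hL : Monotone L) (hU : Monotone U)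
    (h : CountDom L U) {a : ℝ} (ha : 0 ≤ a) :
    coalTime L U ≤ a ↔ ∀ x, a ≤ x → countAbove L x = countAbove U x := by
  by_cases hLU : L = U
  · simp [coalTime, hLU, ha]
  have hle := h.le hL hU
  set K : Set ℕ := {k | k < n ∧ coord L k ≠ coord U k} with hK
  have hbdd : BddAbove K := ⟨n, fun k hk => hk.1.le⟩
  have hne : K.Nonempty := by
    obtain ⟨i, hi⟩ := Function.ne_iff.1 hLU
    exact ⟨i, i.2, by rwa [coord_eq, coord_eq]⟩
  obtain ⟨hlt, hdiff⟩ := Nat.sSup_mem hne hbdd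
  obtain ⟨j, hj⟩ : ∃ j : Fin n, (j : ℕ) = sSup K := ⟨⟨_, hlt⟩, rfl⟩
  have hC : coalTime L U = U j := by rw [coalTime, if_neg hLU, ← hK, ← hj, coord_eq]
  rw [← hj, coord_eq, coord_eq] at hdiff
  have hjlt : L j < U j := lt_of_le_of_ne (hle j) hdiff
  rw [hC]
  constructor
  · intro hja x hx
    unfold countAbove
    congr 1
    ext i
    simp only [Finset.mem_filter, Finset.mem_univ, true_and]
    rcases le_or_gt i j with hij | hij
    · have h1 := hU hij
      have h2 := hle i
      exact iff_of_false (by linarith) (by linarith)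
    · have : L i = U i := by
        by_contra hi
        have : (i : ℕ) ≤ sSup K := le_csSup hbdd ⟨i.2, by rwa [coord_eq, coord_eq]⟩
        rw [← hj] at this
        exact absurd hij (not_lt.2 this)
      rw [this]
  · intro hx
    by_contra! hja
    have h1 := (lt_iff_le_countAbove hU j (max a (L j))).1 (max_lt hja hjlt)
    rw [← hx _ (le_max_left _ _), ← lt_iff_le_countAbove hL] at h1
    exact (le_max_right a (L j)).not_gt h1

lemma coalTime_dec_le_iff {n : ℕ} {L U : Fin n → ℝ} (hL : IsWorkload L) (hU : IsWorkload U)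
    (h : CountDom L U) {t a : ℝ} (ht : 0 ≤ t) (ha : 0 ≤ a) :
    coalTime (dec t L) (dec t U) ≤ a ↔ coalTime L U ≤ a + t := by
  rw [coalTime_le_iff (hL.dec t).1 (hU.dec t).1 (h.dec hU t) ha,
    coalTime_le_iff hL.1 hU.1 h (add_nonneg ha ht)]
  constructor
  · intro H x hx
    have := H (x - t) (by linarith)
    rwa [countAbove_dec _ (by linarith), countAbove_dec _ (by linarith), sub_add_cancel] at this
  · intro H x hx
    rw [countAbove_dec _ (ha.trans hx), countAbove_dec _ (ha.trans hx)]
    exact H _ (by linarith)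

/-- After an arrival, coalescence takes at least as long as before it, and, when the least busy
servers differ, at least until the new service in `U` is completed. -/
lemma coalTime_le_of_coalTime_arr_le {n : ℕ} (hn : 0 < n) {L U : Fin n → ℝ} (hL : IsWorkload L)
    (hU : IsWorkload U) (h : CountDom L U) {S a : ℝ} (hS : 0 ≤ S) (ha : 0 ≤ a)
    (hC : coalTime (arr S L) (arr S U) ≤ a) :
    coalTime L U ≤ a ∧ (coord L 0 < coord U 0 → coord U 0 + S ≤ a) := by
  rw [coalTime_le_iff (hL.arr hS).1 (hU.arr hS).1 (h.arr hn le_rfl hL.1 hU.1 hS) ha] at hC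
  have h0 := h.coord_zero_le hn le_rfl hL.1 hU.1
  have key : coord L 0 < coord U 0 → coord U 0 + S ≤ a := by
    intro hlt
    by_contra! hlt'
    have hy : max a (coord L 0 + S) < coord U 0 + S := max_lt hlt' (by linarith)
    have hLy := countAbove_arr hn S L (max a (coord L 0 + S))
    have hUy := countAbove_arr hn S U (max a (coord L 0 + S))
    have hCy := hC _ (le_max_left a (coord L 0 + S))
    have hyL := le_max_right a (coord L 0 + S)
    generalize max a (coord L 0 + S) = y at *
    have hLU := h.countAbove_le_countAbove y
    have hLn := mt (lt_coord_zero_iff hn hL.1 y).2 (by linarith)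
    have hLc := countAbove_le L y
    rw [if_neg (by linarith), if_neg (by linarith)] at hLy
    rw [if_pos hy] at hUy
    by_cases hyU : y < coord U 0
    · have := (lt_coord_zero_iff hn hU.1 y).1 hyU
      rw [if_pos hyU] at hUy
      omega
    · rw [if_neg hyU] at hUy
      omega
  refine ⟨(coalTime_le_iff hL.1 hU.1 h ha).2 fun x hx => ?_, key⟩
  have hLx := countAbove_arr hn S L x
  have hUx := countAbove_arr hn S U x
  have hCx := hC x hx
  rcases h0.eq_or_lt with heq | hlt
  · rw [heq] at hLx
    omega
  · have := key hlt
    rw [if_neg (by linarith), if_neg (by linarith)] at hLx hUx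
    omega

lemma coalTime_arr_le {n : ℕ} (hn : 0 < n) {L U : Fin n → ℝ} (hL : IsWorkload L)
    (hU : IsWorkload U) (h : CountDom L U) {S a : ℝ} (hS : 0 ≤ S) (ha : 0 ≤ a)
    (hC : coalTime L U ≤ a) (h0 : coord L 0 < coord U 0 → coord U 0 + S ≤ a) :
    coalTime (arr S L) (arr S U) ≤ a := by
  rw [coalTime_le_iff hL.1 hU.1 h ha] at hC
  rw [coalTime_le_iff (hL.arr hS).1 (hU.arr hS).1 (h.arr hn le_rfl hL.1 hU.1 hS) ha]
  intro x hx
  have hLx := countAbove_arr hn S L x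
  have hUx := countAbove_arr hn S U x
  have hCx := hC x hx
  rcases (h.coord_zero_le hn le_rfl hL.1 hU.1).eq_or_lt with heq | hlt
  · rw [heq] at hLx
    omega
  · have := h0 hlt
    rw [if_neg (by linarith), if_neg (by linarith)] at hLx hUx
    omega

/-- The sandwiching processes with `a` servers (`W ≤ V`) and with `b` servers (`L ≤ U`), the former
coalescing no later than the latter. -/
structure Sandwich {a b : ℕ} (W V : Fin a → ℝ) (L U : Fin b → ℝ) : Prop where
  workload_W : IsWorkload W
  workload_V : IsWorkload V
  workload_L : IsWorkload L
  workload_U : IsWorkload U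
  dom_WV : CountDom W V
  dom_LU : CountDom L U
  dom_VU : CountDom V U
  coalTime_le : coalTime W V ≤ coalTime L U

lemma Sandwich.dec {a b : ℕ} {W V : Fin a → ℝ} {L U : Fin b → ℝ} (h : Sandwich W V L U)
    {t : ℝ} (ht : 0 ≤ t) : Sandwich (dec t W) (dec t V) (dec t L) (dec t U) where
  workload_W := h.workload_W.dec t
  workload_V := h.workload_V.dec t
  workload_L := h.workload_L.dec t
  workload_U := h.workload_U.dec t
  dom_WV := h.dom_WV.dec h.workload_V t
  dom_LU := h.dom_LU.dec h.workload_U t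
  dom_VU := h.dom_VU.dec h.workload_U t
  coalTime_le := by
    have ha := coalTime_nonneg (_root_.dec t L) (h.workload_U.dec t)
    rw [coalTime_dec_le_iff h.workload_W h.workload_V h.dom_WV ht ha]
    exact h.coalTime_le.trans
      ((coalTime_dec_le_iff h.workload_L h.workload_U h.dom_LU ht ha).1 le_rfl)

lemma Sandwich.arr {a b : ℕ} (hb : 0 < b) (hab : b ≤ a) {W V : Fin a → ℝ} {L U : Fin b → ℝ}
    (h : Sandwich W V L U) {S : ℝ} (hS : 0 ≤ S)
    (hcond : L ≠ U → coord L 0 = coord U 0 → coord U 0 = 0) :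
    Sandwich (arr S W) (arr S V) (arr S L) (arr S U) where
  workload_W := h.workload_W.arr hS
  workload_V := h.workload_V.arr hS
  workload_L := h.workload_L.arr hS
  workload_U := h.workload_U.arr hS
  dom_WV := h.dom_WV.arr (hb.trans_le hab) le_rfl h.workload_W.1 h.workload_V.1 hS
  dom_LU := h.dom_LU.arr hb le_rfl h.workload_L.1 h.workload_U.1 hS
  dom_VU := h.dom_VU.arr hb hab h.workload_V.1 h.workload_U.1 hS
  coalTime_le := by
    have ha := coalTime_nonneg (_root_.arr S L) (h.workload_U.arr hS)
    obtain ⟨hC, hkey⟩ := coalTime_le_of_coalTime_arr_le hb h.workload_L h.workload_U h.dom_LU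
      hS ha le_rfl
    refine coalTime_arr_le (hb.trans_le hab) h.workload_W h.workload_V h.dom_WV hS ha
      (h.coalTime_le.trans hC) fun hWV => ?_
    have hVU := h.dom_VU.coord_zero_le hb hab h.workload_V.1 h.workload_U.1
    have hW0 := coord_zero_nonneg h.workload_W
    have hne : L ≠ U := by
      intro hLU
      have hle : coalTime W V ≤ 0 := h.coalTime_le.trans (by simp [coalTime, hLU])
      have hx := (coalTime_le_iff h.workload_W.1 h.workload_V.1 h.dom_WV le_rfl).1 hle _ hW0
      rw [(lt_coord_zero_iff (hb.trans_le hab) h.workload_V.1 _).1 hWV,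
        ← lt_coord_zero_iff (hb.trans_le hab) h.workload_W.1] at hx
      exact lt_irrefl _ hx
    have hLU : coord L 0 < coord U 0 := by
      refine lt_of_le_of_ne
        (h.dom_LU.coord_zero_le hb le_rfl h.workload_L.1 h.workload_U.1) fun heq => ?_
      have := hcond hne heq
      linarith
    have := hkey hLU
    linarith

lemma isWorkload_zero {n : ℕ} : IsWorkload (fun _ : Fin n => (0 : ℝ)) :=
  ⟨monotone_const, fun _ => le_rfl⟩

lemma isWorkload_of_padding {c m : ℕ} {V : Fin (c + m) → ℝ} {U : Fin c → ℝ} (hU : IsWorkload U)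
    (hzero : ∀ k, k < m → coord V k = 0) (hpad : ∀ k, k < c → coord V (k + m) = coord U k) :
    IsWorkload V := by
  have hlow : ∀ i : Fin (c + m), (i : ℕ) < m → V i = 0 := fun i hi => by
    rw [← coord_eq V, hzero i hi]
  have hhigh : ∀ i : Fin (c + m), (hi : m ≤ i) → V i = U ⟨i - m, by omega⟩ := fun i hi => by
    have h := hpad (i - m) (by omega)
    rw [Nat.sub_add_cancel hi, coord_eq] at h
    rw [h, ← coord_eq U]
  have hnonneg : ∀ i, 0 ≤ V i := fun i => by
    rcases lt_or_ge (i : ℕ) m with hi | hi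
    · exact (hlow i hi).ge
    · exact (hhigh i hi).symm ▸ hU.2 _
  refine ⟨fun i j hij => ?_, hnonneg⟩
  rcases lt_or_ge (i : ℕ) m with hi | hi
  · exact (hlow i hi).trans_le (hnonneg j)
  · have hij' : (i : ℕ) ≤ j := hij
    rw [hhigh i hi, hhigh j (hi.trans hij')]
    exact hU.1 (Nat.sub_le_sub_right hij' m)

lemma countAbove_zero {n : ℕ} {x : ℝ} (hx : 0 ≤ x) :
    countAbove (fun _ : Fin n => (0 : ℝ)) x = 0 := by
  simp [countAbove, hx]

lemma sandwich_zero {a b : ℕ} (hb : 0 < b) {V : Fin a → ℝ} {U : Fin b → ℝ} (hV : IsWorkload V)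
    (hU : IsWorkload U) (h : CountDom V U) :
    Sandwich (fun _ => 0) V (fun _ => 0) U where
  workload_W := isWorkload_zero
  workload_V := hV
  workload_L := isWorkload_zero
  workload_U := hU
  dom_WV := CountDom.of_le hV.2
  dom_LU := CountDom.of_le hU.2
  dom_VU := h
  coalTime_le := by
    have ha := coalTime_nonneg (fun _ => 0) hU
    rw [coalTime_le_iff isWorkload_zero.1 hV.1 (CountDom.of_le hV.2) ha]
    intro x hx
    have hUx := (coalTime_le_iff isWorkload_zero.1 hU.1 (CountDom.of_le hU.2) ha).1 le_rfl x hx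
    rw [countAbove_zero (ha.trans hx)] at hUx ⊢
    have := h x
    omega

/-- Theorem 3.5, discrete form: under the stated condition on the
`c`-server sandwiching processes, the times-to-coalescence with `c+m` servers are
dominated by those with `c` servers, both pre- and post-arrival, for all `n`. -/
theorem stmt12 {c m : ℕ} (hc : 1 ≤ c) (hm : 1 ≤ m)
    (S τ : ℕ → ℝ) (hS : ∀ n, 0 < S n) (hτ : ∀ n, 0 ≤ τ n)
    (U0 : Fin c → ℝ) (hU0 : IsWorkload U0)
    (Uc Lc : ℕ → Fin c → ℝ) (Ucm Lcm : ℕ → Fin (c + m) → ℝ)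
    (hUc0 : Uc 0 = U0)
    (hLc0 : Lc 0 = fun _ => 0)
    (hUcm0zero : ∀ k : ℕ, k < m → coord (Ucm 0) k = 0)
    (hUcm0pad : ∀ k : ℕ, k < c → coord (Ucm 0) (k + m) = coord U0 k)
    (hLcm0 : Lcm 0 = fun _ => 0)
    (hUc : ∀ n, Uc (n + 1) = arr (S (n + 1)) (dec (τ n) (Uc n)))
    (hLc : ∀ n, Lc (n + 1) = arr (S (n + 1)) (dec (τ n) (Lc n)))
    (hUcm : ∀ n, Ucm (n + 1) = arr (S (n + 1)) (dec (τ n) (Ucm n)))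
    (hLcm : ∀ n, Lcm (n + 1) = arr (S (n + 1)) (dec (τ n) (Lcm n)))
    (hcond : ∀ n, dec (τ n) (Lc n) ≠ dec (τ n) (Uc n) →
      coord (dec (τ n) (Lc n)) 0 = coord (dec (τ n) (Uc n)) 0 →
      coord (dec (τ n) (Uc n)) 0 = 0) :
    ∀ n, coalTime (Lcm n) (Ucm n) ≤ coalTime (Lc n) (Uc n) ∧
      coalTime (dec (τ n) (Lcm n)) (dec (τ n) (Ucm n)) ≤
        coalTime (dec (τ n) (Lc n)) (dec (τ n) (Uc n)) := by
  have main : ∀ n, Sandwich (Lcm n) (Ucm n) (Lc n) (Uc n) := by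
    intro n
    induction n with
    | zero =>
      have hV := isWorkload_of_padding hU0 hUcm0zero hUcm0pad
      have hdom : OrdDom (Ucm 0) U0 := fun k hk => (hUcm0pad k hk).le
      rw [hLc0, hLcm0, hUc0]
      exact sandwich_zero hc hV hU0 (hdom.countDom hV.1 hU0.1)
    | succ n ih =>
      rw [hUc, hLc, hUcm, hLcm]
      exact (ih.dec (hτ n)).arr hc (Nat.le_add_right c m) (hS (n + 1)).le (hcond n)
  exact fun n => ⟨(main n).coalTime_le, ((main n).dec (hτ n)).coalTime_le⟩
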